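/- arXiv:cs/0611119 — 4 statements merged into one kernel-verified Lean document; each statement's English description precedes it below -/
import Mathlib

section
/- There is no QTL formula φ (in a single atomic proposition p) such that for every valuation P ⊆ [0,∞) and every t ∈ [0,∞), φ holds at t under the valuation P if and only if the set P ∩ (t, t+1) contains at least two points. (Pnueli's conjecture: the counting modality C₂ is not expressible in QTL over the nonnegative real line.) -/
/-- Syntax of QTL formulas over a single atomic proposition `p`. -/
inductive QTL : Type
  | top : QTL
  | atom : QTL
  | not : QTL → QTL
  | and : QTL → QTL → QTL
  | until_ : QTL → QTL → QTL
  | since : QTL → QTL → QTL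
  | diam : QTL → QTL
  | diamBar : QTL → QTL

/-- Satisfaction of QTL formulas over the time domain `[0,∞)`, with valuation `P` for `p`. -/
def QTL.Sat (P : Set ℝ) : QTL → ℝ → Prop
  | .top, _ => True
  | .atom, t => t ∈ P
  | .not φ, t => ¬ QTL.Sat P φ t
  | .and φ ψ, t => QTL.Sat P φ t ∧ QTL.Sat P ψ t
  | .until_ φ ψ, t => ∃ t₁, 0 ≤ t₁ ∧ t < t₁ ∧ QTL.Sat P ψ t₁ ∧
      ∀ s, 0 ≤ s → t < s → s < t₁ → QTL.Sat P φ s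
  | .since φ ψ, t => ∃ t₁, 0 ≤ t₁ ∧ t₁ < t ∧ QTL.Sat P ψ t₁ ∧
      ∀ s, 0 ≤ s → t₁ < s → s < t → QTL.Sat P φ s
  | .diam φ, t => ∃ s, 0 ≤ s ∧ t < s ∧ s < t + 1 ∧ QTL.Sat P φ s
  | .diamBar φ, t => ∃ s, 0 ≤ s ∧ s < t ∧ t < s + 1 ∧ QTL.Sat P φ s

/-- The nonnegative multiples of `3/4`. -/
def gridValuation : Set ℝ := {x | 0 ≤ x ∧ ∃ k : ℤ, x = 3 / 4 * k}

lemma gridValuation_gap {k : ℤ} {x : ℝ} (h₁ : 3 / 4 * (k : ℝ) < x)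
    (h₂ : x < 3 / 4 * ((k : ℝ) + 1)) : x ∉ gridValuation := by
  rintro ⟨-, m, rfl⟩
  have h₃ : (k : ℝ) < m := by linarith
  have h₄ : (m : ℝ) < k + 1 := by linarith
  norm_cast at h₃ h₄
  omega

lemma exists_next_gridValuation {t : ℝ} (ht : 0 ≤ t) :
    ∃ u ∈ gridValuation, t < u ∧ u < t + 1 ∧ ∀ x, t < x → x < u → x ∉ gridValuation := by
  have h₁ := Int.floor_le (t * (4 / 3))
  have h₂ := Int.lt_floor_add_one (t * (4 / 3))
  refine ⟨3 / 4 * ((⌊t * (4 / 3)⌋ : ℝ) + 1), ⟨by linarith, ⌊t * (4 / 3)⌋ + 1, by push_cast; ring⟩,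
    by linarith, by linarith, fun x hx hxu => gridValuation_gap (by linarith) hxu⟩

lemma exists_prev_gridValuation {t : ℝ} (ht : 1 ≤ t) :
    ∃ u ∈ gridValuation, u < t ∧ t < u + 1 ∧ ∀ x, u < x → x < t → x ∉ gridValuation := by
  have h₁ := Int.le_ceil (t * (4 / 3))
  have h₂ := Int.ceil_lt_add_one (t * (4 / 3))
  refine ⟨3 / 4 * ((⌈t * (4 / 3)⌉ : ℝ) - 1), ⟨by linarith, ⌈t * (4 / 3)⌉ - 1, by push_cast; ring⟩,
    by linarith, by linarith, fun x hux hx => ?_⟩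
  refine gridValuation_gap (k := ⌈t * (4 / 3)⌉ - 1) (by push_cast; linarith)
    (by push_cast; linarith)

lemma exists_notMem_gridValuation {a b : ℝ} (ha : 0 ≤ a) (hab : a < b) :
    ∃ x, a < x ∧ x < b ∧ x ∉ gridValuation := by
  obtain ⟨u, -, hau, -, hu⟩ := exists_next_gridValuation ha
  obtain ⟨x, hax, hx⟩ := exists_between (lt_min hab hau)
  exact ⟨x, hax, hx.trans_le (min_le_left _ _), hu x hax (hx.trans_le (min_le_right _ _))⟩

lemma exists_mem_iff_gridValuation {t : ℝ} (ht : 0 ≤ t) (s : ℝ) :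
    ∃ x, t < x ∧ x < t + 1 ∧ (s ∈ gridValuation ↔ x ∈ gridValuation) := by
  by_cases hs : s ∈ gridValuation
  · obtain ⟨u, hu, h₁, h₂, -⟩ := exists_next_gridValuation ht
    exact ⟨u, h₁, h₂, by tauto⟩
  · obtain ⟨u, h₁, h₂, hu⟩ := exists_notMem_gridValuation ht (lt_add_one t)
    exact ⟨u, h₁, h₂, by tauto⟩

/-- Beyond `N`, the truth of `φ` on the grid depends only on membership in the grid. -/
def QTL.StableAfter (φ : QTL) (N : ℝ) : Prop :=
  ∀ s t, N < s → N < t → (s ∈ gridValuation ↔ t ∈ gridValuation) →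
    QTL.Sat gridValuation φ s → QTL.Sat gridValuation φ t

lemma QTL.StableAfter.mono {φ : QTL} {N M : ℝ} (h : φ.StableAfter N) (hNM : N ≤ M) :
    φ.StableAfter M :=
  fun s t hs ht => h s t (hNM.trans_lt hs) (hNM.trans_lt ht)

lemma QTL.StableAfter.until {φ ψ : QTL} {N : ℝ} (hN : 0 ≤ N) (hφ : φ.StableAfter N)
    (hψ : ψ.StableAfter N) : (QTL.until_ φ ψ).StableAfter N := by
  rintro s t hs ht - ⟨s₁, -, hss₁, hψs, hφs⟩
  obtain ⟨y, hsy, hys, hy⟩ := exists_notMem_gridValuation (hN.trans hs.le) hss₁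
  have hφy := hφs y (by linarith) hsy hys
  obtain ⟨u, hu, htu, -, hgap⟩ := exists_next_gridValuation (hN.trans ht.le)
  have hφu : ∀ x, t < x → x < u → QTL.Sat gridValuation φ x := fun x htx hxu =>
    hφ y x (by linarith) (by linarith) (by have := hgap x htx hxu; tauto) hφy
  by_cases hs₁ : s₁ ∈ gridValuation
  · exact ⟨u, by linarith, htu, hψ s₁ u (by linarith) (by linarith) (by tauto) hψs,
      fun x _ => hφu x⟩
  · obtain ⟨v, htv, hvu⟩ := exists_between htu
    exact ⟨v, by linarith, htv, hψ s₁ v (by linarith) (by linarith)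
      (by have := hgap v htv hvu; tauto) hψs, fun x _ h₁ h₂ => hφu x h₁ (h₂.trans hvu)⟩

lemma QTL.StableAfter.since {φ ψ : QTL} {N : ℝ} (hN : 0 ≤ N) (hφ : φ.StableAfter N)
    (hψ : ψ.StableAfter N) : (QTL.since φ ψ).StableAfter (N + 1) := by
  rintro s t hs ht - ⟨s₁, hs₁0, hss₁, hψs, hφs⟩
  by_cases hle : s₁ ≤ N
  · refine ⟨s₁, hs₁0, by linarith, hψs, fun x hx0 hx _ => ?_⟩
    by_cases hxN : x ≤ N
    · exact hφs x hx0 hx (by linarith)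
    · obtain ⟨y, hNy, hyN, hy⟩ := exists_mem_iff_gridValuation hN x
      exact hφ y x hNy (by linarith) hy.symm
        (hφs y (by linarith) (by linarith) (by linarith))
  obtain ⟨y, hsy, hys, hy⟩ := exists_notMem_gridValuation hs₁0 hss₁
  have hφy := hφs y (by linarith) hsy hys
  obtain ⟨u, hu, hut, htu, hgap⟩ := exists_prev_gridValuation (t := t) (by linarith)
  have hφu : ∀ x, u < x → x < t → QTL.Sat gridValuation φ x := fun x hux hxt =>
    hφ y x (by linarith) (by linarith) (by have := hgap x hux hxt; tauto) hφy
  by_cases hs₁ : s₁ ∈ gridValuation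
  · exact ⟨u, by linarith, hut, hψ s₁ u (by linarith) (by linarith) (by tauto) hψs,
      fun x _ => hφu x⟩
  · obtain ⟨v, huv, hvt⟩ := exists_between hut
    exact ⟨v, by linarith, hvt, hψ s₁ v (by linarith) (by linarith)
      (by have := hgap v huv hvt; tauto) hψs, fun x _ h₁ h₂ => hφu x (huv.trans h₁) h₂⟩

lemma QTL.exists_stableAfter (φ : QTL) : ∃ N, 0 ≤ N ∧ φ.StableAfter N := by
  induction φ with
  | top => exact ⟨0, le_rfl, fun _ _ _ _ _ _ => trivial⟩
  | atom => exact ⟨0, le_rfl, fun _ _ _ _ h => h.1⟩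
  | not φ ih =>
    obtain ⟨N, hN, h⟩ := ih
    exact ⟨N, hN, fun s t hs ht hst hn hφ => hn (h t s ht hs hst.symm hφ)⟩
  | and φ ψ ihφ ihψ =>
    obtain ⟨N, hN, hφ⟩ := ihφ
    obtain ⟨M, -, hψ⟩ := ihψ
    have hφ := hφ.mono (le_max_left N M)
    have hψ := hψ.mono (le_max_right N M)
    exact ⟨max N M, hN.trans (le_max_left N M), fun s t hs ht hst h =>
      ⟨hφ s t hs ht hst h.1, hψ s t hs ht hst h.2⟩⟩
  | until_ φ ψ ihφ ihψ =>
    obtain ⟨N, hN, hφ⟩ := ihφ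
    obtain ⟨M, -, hψ⟩ := ihψ
    have h0 := hN.trans (le_max_left N M)
    exact ⟨max N M, h0, (hφ.mono (le_max_left N M)).until h0 (hψ.mono (le_max_right N M))⟩
  | since φ ψ ihφ ihψ =>
    obtain ⟨N, hN, hφ⟩ := ihφ
    obtain ⟨M, -, hψ⟩ := ihψ
    have h0 := hN.trans (le_max_left N M)
    exact ⟨max N M + 1, by linarith,
      (hφ.mono (le_max_left N M)).since h0 (hψ.mono (le_max_right N M))⟩
  | diam φ ih =>
    obtain ⟨N, hN, h⟩ := ih
    refine ⟨N, hN, ?_⟩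
    rintro s t hs ht - ⟨x, hx0, hsx, -, hx⟩
    obtain ⟨y, hty, hyt, hxy⟩ := exists_mem_iff_gridValuation (hN.trans ht.le) x
    exact ⟨y, by linarith, hty, hyt, h x y (by linarith) (by linarith) hxy hx⟩
  | diamBar φ ih =>
    obtain ⟨N, hN, h⟩ := ih
    refine ⟨N + 1, by linarith, ?_⟩
    rintro s t hs ht - ⟨x, hx0, hsx, hxs, hx⟩
    obtain ⟨y, hty, hyt, hxy⟩ := exists_mem_iff_gridValuation (t := t - 1) (by linarith) x
    exact ⟨y, by linarith, by linarith, by linarith,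
      h x y (by linarith) (by linarith) hxy hx⟩

/-- Pnueli's conjecture: the counting modality `C₂` is not expressible in QTL
over the nonnegative real line. -/
theorem C2_not_expressible_in_QTL :
    ¬ ∃ φ : QTL, ∀ P : Set ℝ, P ⊆ Set.Ici (0 : ℝ) → ∀ t : ℝ, 0 ≤ t →
      (QTL.Sat P φ t ↔ 2 ≤ (P ∩ Set.Ioo t (t + 1)).encard) := by
  rintro ⟨φ, hφ⟩
  obtain ⟨N, hN, hst⟩ := φ.exists_stableAfter
  specialize hφ gridValuation (fun x hx => hx.1)
  obtain ⟨u, ⟨hu0, k, rfl⟩, hNu, -⟩ := exists_next_gridValuation hN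
  have h₁ := (hφ (3 / 4 * k + 5 / 8) (by linarith)).2 (by
    rw [← Set.encard_pair (show 3 / 4 * ((k + 1 : ℤ) : ℝ) ≠ 3 / 4 * ((k + 2 : ℤ) : ℝ) by
      push_cast; intro h; linarith)]
    refine Set.encard_le_encard ?_
    rintro x (rfl | rfl)
    · exact ⟨⟨by push_cast; linarith, k + 1, rfl⟩, by push_cast; linarith, by push_cast; linarith⟩
    · exact ⟨⟨by push_cast; linarith, k + 2, rfl⟩, by push_cast; linarith, by push_cast; linarith⟩)
  have h₂ : QTL.Sat gridValuation φ (3 / 4 * k + 1 / 4) :=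
    hst _ _ (by linarith) (by linarith) (iff_of_false
      (gridValuation_gap (k := k) (by linarith) (by linarith))
      (gridValuation_gap (k := k) (by linarith) (by linarith))) h₁
  have h₃ := (hφ _ (by linarith)).1 h₂
  have h₄ : (gridValuation ∩ Set.Ioo (3 / 4 * (k : ℝ) + 1 / 4) (3 / 4 * k + 1 / 4 + 1)).encard
      ≤ 1 := by
    have key : ∀ x ∈ gridValuation ∩ Set.Ioo (3 / 4 * (k : ℝ) + 1 / 4) (3 / 4 * k + 1 / 4 + 1),
        x = 3 / 4 * ((k + 1 : ℤ) : ℝ) := by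
      rintro x ⟨⟨-, m, rfl⟩, hlt, hgt⟩
      have h₅ : (k : ℝ) < m := by linarith
      have h₆ : (m : ℝ) < k + 2 := by linarith
      norm_cast at h₅ h₆
      rw [show m = k + 1 by omega]
    exact Set.encard_le_one_iff.2 fun a b ha hb => (key a ha).trans (key b hb).symm
  exact absurd (h₃.trans h₄) (by norm_num)
end

section
/- For every integer n ≥ 2, there is no QTL(P₂,…,P_{n-1}) formula φ (in a single atomic proposition p) such that for every valuation P ⊆ [0,∞) and every t ∈ [0,∞), φ holds at t under the valuation P if and only if the set P ∩ (t, t+1) contains at least n points. (The counting modality C_n is not expressible in QTL extended with the Pnueli modalities P₂,…,P_{n-1}.) -/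
/-- Syntax of QTL formulas over a single atomic proposition `p`, extended with the
Pnueli modalities `P_j` of every arity `j`. -/
inductive QTLP : Type
  | top : QTLP
  | atom : QTLP
  | not : QTLP → QTLP
  | and : QTLP → QTLP → QTLP
  | until_ : QTLP → QTLP → QTLP
  | since : QTLP → QTLP → QTLP
  | diam : QTLP → QTLP
  | diamBar : QTLP → QTLP
  | pnueli : (j : ℕ) → (Fin j → QTLP) → QTLP

/-- Satisfaction over the time domain `[0,∞)`, with valuation `P` for `p`. -/
def QTLP.Sat (P : Set ℝ) : QTLP → ℝ → Prop
  | .top, _ => True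
  | .atom, t => t ∈ P
  | .not φ, t => ¬ QTLP.Sat P φ t
  | .and φ ψ, t => QTLP.Sat P φ t ∧ QTLP.Sat P ψ t
  | .until_ φ ψ, t => ∃ t₁, 0 ≤ t₁ ∧ t < t₁ ∧ QTLP.Sat P ψ t₁ ∧
      ∀ s, 0 ≤ s → t < s → s < t₁ → QTLP.Sat P φ s
  | .since φ ψ, t => ∃ t₁, 0 ≤ t₁ ∧ t₁ < t ∧ QTLP.Sat P ψ t₁ ∧
      ∀ s, 0 ≤ s → t₁ < s → s < t → QTLP.Sat P φ s
  | .diam φ, t => ∃ s, 0 ≤ s ∧ t < s ∧ s < t + 1 ∧ QTLP.Sat P φ s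
  | .diamBar φ, t => ∃ s, 0 ≤ s ∧ s < t ∧ t < s + 1 ∧ QTLP.Sat P φ s
  | .pnueli j args, t => ∃ ts : Fin j → ℝ, StrictMono ts ∧
      (∀ i, 0 ≤ ts i ∧ t < ts i ∧ ts i < t + 1) ∧
      ∀ i, QTLP.Sat P (args i) (ts i)

/-- `φ` is a formula of `QTL(P₂,…,P_n)`: every Pnueli modality occurring in `φ`
has arity `j` with `2 ≤ j ≤ n`. -/
def QTLP.ArityOK (n : ℕ) : QTLP → Prop
  | .top => True
  | .atom => True
  | .not φ => QTLP.ArityOK n φ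
  | .and φ ψ => QTLP.ArityOK n φ ∧ QTLP.ArityOK n ψ
  | .until_ φ ψ => QTLP.ArityOK n φ ∧ QTLP.ArityOK n ψ
  | .since φ ψ => QTLP.ArityOK n φ ∧ QTLP.ArityOK n ψ
  | .diam φ => QTLP.ArityOK n φ
  | .diamBar φ => QTLP.ArityOK n φ
  | .pnueli j args => 2 ≤ j ∧ j ≤ n ∧ ∀ i, QTLP.ArityOK n (args i)

/-- The points `0, δ, 2δ, …`. -/
def comb (δ : ℝ) : Set ℝ := Set.range fun k : ℕ => (k : ℝ) * δ

theorem notMem_comb {δ x : ℝ} (hδ : 0 < δ) {k : ℕ} (h₁ : k * δ < x) (h₂ : x < (k + 1) * δ) :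
    x ∉ comb δ := by
  rintro ⟨l, rfl⟩
  have h₃ : (k : ℝ) < l := lt_of_mul_lt_mul_right h₁ hδ.le
  have h₄ : (l : ℝ) < (k + 1 : ℕ) := by
    push_cast
    exact lt_of_mul_lt_mul_right h₂ hδ.le
  have h₅ : k < l := by exact_mod_cast h₃
  have h₆ : l < k + 1 := by exact_mod_cast h₄
  omega

theorem exists_comb_le_lt {δ t : ℝ} (hδ : 0 < δ) (ht : 0 ≤ t) :
    ∃ k : ℕ, k * δ ≤ t ∧ t < (k + 1) * δ :=
  ⟨⌊t / δ⌋₊, (le_div_iff₀ hδ).1 (Nat.floor_le (by positivity)),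
    (div_lt_iff₀ hδ).1 (Nat.lt_floor_add_one _)⟩

theorem exists_comb_lt_le {δ t : ℝ} (hδ : 0 < δ) (ht : 0 < t) :
    ∃ k : ℕ, k * δ < t ∧ t ≤ (k + 1) * δ := by
  obtain ⟨k, hk, hk'⟩ := exists_comb_le_lt hδ ht.le
  rcases hk.lt_or_eq with h | h
  · exact ⟨k, h, hk'.le⟩
  · cases k with
    | zero => simp at h; linarith
    | succ k =>
      refine ⟨k, ?_, ?_⟩ <;> push_cast at h <;> nlinarith

/-- Just after `t ≥ 0` comes a gap of `comb δ`, which ends in a point `u` of `comb δ`. -/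
theorem exists_next_comb {δ t : ℝ} (hδ : 0 < δ) (ht : 0 ≤ t) :
    ∃ u ∈ comb δ, t < u ∧ u ≤ t + δ ∧ ∀ x, t < x → x < u → x ∉ comb δ := by
  obtain ⟨k, hk, hk'⟩ := exists_comb_le_lt hδ ht
  exact ⟨(k + 1) * δ, ⟨k + 1, by push_cast; rfl⟩, hk', by linarith,
    fun x h₁ h₂ => notMem_comb hδ (hk.trans_lt h₁) h₂⟩

/-- Just before `t > 0` comes a gap of `comb δ`, which starts in a point `u` of `comb δ`. -/
theorem exists_prev_comb {δ t : ℝ} (hδ : 0 < δ) (ht : 0 < t) :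
    ∃ u ∈ comb δ, 0 ≤ u ∧ u < t ∧ t ≤ u + δ ∧ ∀ x, u < x → x < t → x ∉ comb δ := by
  obtain ⟨k, hk, hk'⟩ := exists_comb_lt_le hδ ht
  exact ⟨k * δ, ⟨k, rfl⟩, by positivity, hk, by linarith,
    fun x h₁ h₂ => notMem_comb hδ h₁ (h₂.trans_le hk')⟩

/-- For large times, the truth of `X` depends only on membership in `P`. -/
def EventuallyDeterminedBy (P : Set ℝ) (X : ℝ → Prop) : Prop :=
  ∃ N, 0 ≤ N ∧ ∀ s t, N < s → N < t → (s ∈ P ↔ t ∈ P) → X s → X t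

theorem QTLP.eventuallyDeterminedBy_comb {δ : ℝ} {m : ℕ} (hδ : 0 < δ) (hδ₁ : δ < 1)
    (hm : m * δ < 1) (φ : QTLP) (hφ : φ.ArityOK m) :
    EventuallyDeterminedBy (comb δ) (QTLP.Sat (comb δ) φ) := by
  induction φ with
  | top => exact ⟨0, le_rfl, fun _ _ _ _ _ _ => trivial⟩
  | atom => exact ⟨0, le_rfl, fun _ _ _ _ h => h.1⟩
  | not φ ih =>
    obtain ⟨N, hN, h⟩ := ih hφ
    exact ⟨N, hN, fun s t hs ht hst hX hY => hX (h t s ht hs hst.symm hY)⟩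
  | and φ ψ ih₁ ih₂ =>
    obtain ⟨N₁, hN₁, h₁⟩ := ih₁ hφ.1
    obtain ⟨N₂, hN₂, h₂⟩ := ih₂ hφ.2
    refine ⟨max N₁ N₂, le_max_of_le_left hN₁, fun s t hs ht hst hX => ?_⟩
    rw [max_lt_iff] at hs ht
    exact ⟨h₁ s t hs.1 ht.1 hst hX.1, h₂ s t hs.2 ht.2 hst hX.2⟩
  | until_ φ ψ ih₁ ih₂ =>
    obtain ⟨N₁, hN₁, h₁⟩ := ih₁ hφ.1
    obtain ⟨N₂, hN₂, h₂⟩ := ih₂ hφ.2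
    refine ⟨max N₁ N₂, le_max_of_le_left hN₁, fun s t hs ht _ hX => ?_⟩
    rw [max_lt_iff] at hs ht
    obtain ⟨s₁, hs₁, hlt, hψ, hφ⟩ := hX
    obtain ⟨v, hv, hsv, -, hgap'⟩ := exists_next_comb hδ (hN₁.trans hs.1.le)
    obtain ⟨u, hu, htu, -, hgap⟩ := exists_next_comb hδ (hN₁.trans ht.1.le)
    have hφ' : ∀ x, N₁ < x → x ∉ comb δ → QTLP.Sat (comb δ) φ x := by
      intro x hx hxP
      obtain ⟨y, hy, hy'⟩ := exists_between (lt_min hsv hlt)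
      rw [lt_min_iff] at hy'
      exact h₁ y x (by linarith) hx (iff_of_false (hgap' y hy hy'.1) hxP)
        (hφ y (by linarith) hy hy'.2)
    by_cases hP : s₁ ∈ comb δ
    · exact ⟨u, by linarith, htu, h₂ s₁ u (by linarith) (by linarith) (iff_of_true hP hu) hψ,
        fun x _ hx hx' => hφ' x (by linarith) (hgap x hx hx')⟩
    · obtain ⟨w, hw, hw'⟩ := exists_between htu
      exact ⟨w, by linarith, hw,
        h₂ s₁ w (by linarith) (by linarith) (iff_of_false hP (hgap w hw hw')) hψ,
        fun x _ hx hx' => hφ' x (by linarith) (hgap x hx (hx'.trans hw'))⟩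
  | since φ ψ ih₁ ih₂ =>
    obtain ⟨N₁, hN₁, h₁⟩ := ih₁ hφ.1
    obtain ⟨N₂, hN₂, h₂⟩ := ih₂ hφ.2
    obtain ⟨N, hN₁', hN₂'⟩ : ∃ N, N₁ ≤ N ∧ N₂ ≤ N := ⟨_, le_max_left _ _, le_max_right _ _⟩
    refine ⟨N + 1, by linarith, fun s t hs ht _ hX => ?_⟩
    obtain ⟨s₁, hs₁, hlt, hψ, hφ⟩ := hX
    obtain ⟨v, hv, -, hvs, hvs', hgap'⟩ := exists_prev_comb hδ (show 0 < s by linarith)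
    obtain ⟨u, hu, hu₀, hut, hut', hgap⟩ := exists_prev_comb hδ (show 0 < t by linarith)
    have hφ' : ∀ x, N < x → x ∉ comb δ → QTLP.Sat (comb δ) φ x := by
      intro x hx hxP
      obtain ⟨y, hy, hy'⟩ := exists_between (max_lt hvs hlt)
      rw [max_lt_iff] at hy
      exact h₁ y x (by linarith) (by linarith) (iff_of_false (hgap' y hy.1 hy') hxP)
        (hφ y (by linarith) hy.2 hy')
    rcases le_or_gt s₁ N with hs₁N | hs₁N
    · refine ⟨s₁, hs₁, by linarith, hψ, fun x hx hx' hxt => ?_⟩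
      rcases le_or_gt x N with hxN | hxN
      · exact hφ x hx hx' (by linarith)
      · by_cases hxP : x ∈ comb δ
        · exact h₁ v x (by linarith) (by linarith) (iff_of_true hv hxP)
            (hφ v (by linarith) (by linarith) hvs)
        · exact hφ' x hxN hxP
    · by_cases hP : s₁ ∈ comb δ
      · exact ⟨u, hu₀, hut, h₂ s₁ u (by linarith) (by linarith) (iff_of_true hP hu) hψ,
          fun x _ hx hx' => hφ' x (by linarith) (hgap x hx hx')⟩
      · obtain ⟨w, hw, hw'⟩ := exists_between hut
        exact ⟨w, by linarith, hw',
          h₂ s₁ w (by linarith) (by linarith) (iff_of_false hP (hgap w hw hw')) hψ,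
          fun x _ hx hx' => hφ' x (by linarith) (hgap x (hw.trans hx) hx')⟩
  | diam φ ih =>
    obtain ⟨N, hN, h⟩ := ih hφ
    refine ⟨N, hN, fun s t hs ht _ hX => ?_⟩
    obtain ⟨s₁, hs₁, hlt, hlt', hX⟩ := hX
    obtain ⟨u, hu, htu, htu', hgap⟩ := exists_next_comb hδ (hN.trans ht.le)
    by_cases hP : s₁ ∈ comb δ
    · exact ⟨u, by linarith, htu, by linarith,
        h s₁ u (by linarith) (by linarith) (iff_of_true hP hu) hX⟩
    · obtain ⟨w, hw, hw'⟩ := exists_between htu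
      exact ⟨w, by linarith, hw, by linarith,
        h s₁ w (by linarith) (by linarith) (iff_of_false hP (hgap w hw hw')) hX⟩
  | diamBar φ ih =>
    obtain ⟨N, hN, h⟩ := ih hφ
    refine ⟨N + 1, by linarith, fun s t hs ht _ hX => ?_⟩
    obtain ⟨s₁, hs₁, hlt, hlt', hX⟩ := hX
    obtain ⟨u, hu, hu₀, hut, hut', hgap⟩ := exists_prev_comb hδ (show 0 < t by linarith)
    by_cases hP : s₁ ∈ comb δ
    · exact ⟨u, hu₀, hut, by linarith,
        h s₁ u (by linarith) (by linarith) (iff_of_true hP hu) hX⟩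
    · obtain ⟨w, hw, hw'⟩ := exists_between hut
      exact ⟨w, by linarith, hw', by linarith,
        h s₁ w (by linarith) (by linarith) (iff_of_false hP (hgap w hw hw')) hX⟩
  | pnueli j args ih =>
    obtain ⟨-, hj, hargs⟩ := hφ
    choose N hN h using fun i => ih i (hargs i)
    have hNle : ∀ i, N i ≤ ∑ i, N i := fun i =>
      Finset.single_le_sum (fun i _ => hN i) (Finset.mem_univ i)
    refine ⟨∑ i, N i, Finset.sum_nonneg fun i _ => hN i, fun s t hs ht _ hX => ?_⟩
    obtain ⟨ts, -, hts, hX⟩ := hX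
    have ht₀ : 0 ≤ t := (Finset.sum_nonneg fun i _ => hN i).trans ht.le
    obtain ⟨k, hk, hk'⟩ := exists_comb_le_lt hδ ht₀
    obtain ⟨ε, hε, hε'⟩ := exists_between (sub_pos.2 hk')
    classical
    obtain ⟨us, hus⟩ : ∃ us : Fin j → ℝ, us = fun i : Fin j =>
      ((k : ℝ) + 1 + (i : ℕ)) * δ - if ts i ∈ comb δ then 0 else ε := ⟨_, rfl⟩
    have hle : ∀ i : Fin j, us i ≤ ((k : ℝ) + 1 + (i : ℕ)) * δ := by
      intro i
      simp only [hus]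
      split_ifs <;> linarith
    have hge : ∀ i : Fin j, ((k : ℝ) + 1 + (i : ℕ)) * δ - ε ≤ us i := by
      intro i
      simp only [hus]
      split_ifs <;> linarith
    have hlow : ∀ i, t < us i := by
      intro i
      have : 0 ≤ ((i : ℕ) : ℝ) * δ := by positivity
      nlinarith [hge i]
    have hhigh : ∀ i, us i < t + 1 := by
      intro i
      have h₁ : (((i : ℕ) : ℝ) + 1) ≤ m := by exact_mod_cast i.2.trans_le hj
      nlinarith [hle i, mul_le_mul_of_nonneg_right h₁ hδ.le]
    refine ⟨us, fun i i' hii => ?_, fun i => ⟨ht₀.trans (hlow i).le, hlow i, hhigh i⟩,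
      fun i => h i (ts i) (us i) ?_ ?_ ?_ (hX i)⟩
    · have h₁ : (((i : ℕ) : ℝ) + 1) ≤ (i' : ℕ) := by exact_mod_cast hii
      nlinarith [hle i, hge i', mul_le_mul_of_nonneg_right h₁ hδ.le]
    · linarith [hNle i, (hts i).2.1]
    · linarith [hNle i, hlow i]
    · by_cases hP : ts i ∈ comb δ
      · refine iff_of_true hP ⟨k + 1 + i, ?_⟩
        simp [hus, hP]
      · refine iff_of_false hP (notMem_comb hδ (k := k + i) ?_ ?_) <;>
          simp only [hus, hP, if_false] <;> push_cast <;> nlinarith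

theorem encard_comb_inter_Ioo_lt {δ t : ℝ} {n k : ℕ} (hδ : 0 < δ) (hn : n ≠ 0) (hk : k * δ ≤ t)
    (ht : t + 1 ≤ (k + n) * δ) : (comb δ ∩ Set.Ioo t (t + 1)).encard < n := by
  have hsub : comb δ ∩ Set.Ioo t (t + 1) ⊆
      (fun l : ℕ => (l : ℝ) * δ) '' (Finset.Ioo k (k + n) : Finset ℕ) := by
    rintro _ ⟨⟨l, rfl⟩, h₁, h₂⟩
    have h₃ : (k : ℝ) < l := lt_of_mul_lt_mul_right (hk.trans_lt h₁) hδ.le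
    have h₄ : (l : ℝ) < k + n := lt_of_mul_lt_mul_right (h₂.trans_le ht) hδ.le
    refine ⟨l, ?_, rfl⟩
    rw [Finset.mem_coe, Finset.mem_Ioo]
    exact ⟨by exact_mod_cast h₃, by exact_mod_cast h₄⟩
  refine ((Set.encard_le_encard hsub).trans (Set.encard_image_le _ _)).trans_lt ?_
  rw [Set.encard_coe_eq_coe_finsetCard, Nat.card_Ioo]
  exact_mod_cast (by omega)

theorem le_encard_comb_inter_Ioo {δ t : ℝ} {n k : ℕ} (hδ : 0 < δ) (hk : t < (k + 1) * δ)
    (ht : (k + n) * δ < t + 1) : (n : ℕ∞) ≤ (comb δ ∩ Set.Ioo t (t + 1)).encard := by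
  have hinj : Function.Injective fun l : ℕ => (l : ℝ) * δ := fun a b hab => by
    exact_mod_cast mul_right_cancel₀ hδ.ne' hab
  have hsub : (fun l : ℕ => (l : ℝ) * δ) '' (Finset.Icc (k + 1) (k + n) : Finset ℕ) ⊆
      comb δ ∩ Set.Ioo t (t + 1) := by
    rintro _ ⟨l, hl, rfl⟩
    rw [Finset.mem_coe, Finset.mem_Icc] at hl
    have h₁ : (k : ℝ) + 1 ≤ l := by exact_mod_cast hl.1
    have h₂ : (l : ℝ) ≤ k + n := by exact_mod_cast hl.2
    exact ⟨⟨l, rfl⟩, hk.trans_le (mul_le_mul_of_nonneg_right h₁ hδ.le),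
      (mul_le_mul_of_nonneg_right h₂ hδ.le).trans_lt ht⟩
  refine le_trans ?_ (Set.encard_le_encard hsub)
  rw [hinj.encard_image, Set.encard_coe_eq_coe_finsetCard, Nat.card_Icc]
  exact_mod_cast (by omega)

/-- For every `n ≥ 2`, the counting modality `C_n` is not expressible in
`QTL(P₂,…,P_{n-1})` over the nonnegative real line. -/
theorem Cn_not_expressible_in_QTL_Pnueli (n : ℕ) (hn : 2 ≤ n) :
    ¬ ∃ φ : QTLP, QTLP.ArityOK (n - 1) φ ∧
      ∀ P : Set ℝ, P ⊆ Set.Ici (0 : ℝ) → ∀ t : ℝ, 0 ≤ t →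
        (QTLP.Sat P φ t ↔ (n : ℕ∞) ≤ (P ∩ Set.Ioo t (t + 1)).encard) := by
  rintro ⟨φ, hφ, h⟩
  have hn' : (2 : ℝ) ≤ n := by exact_mod_cast hn
  obtain ⟨δ, hδ⟩ : ∃ δ : ℝ, δ = 2 / (2 * n - 1) := ⟨_, rfl⟩
  have hδ₀ : 0 < δ := hδ ▸ div_pos two_pos (by linarith)
  have hnδ : n * δ = 1 + δ / 2 := by
    have : δ * (2 * n - 1) = 2 := hδ ▸ div_mul_cancel₀ 2 (by linarith)
    linarith
  have hm : ((n - 1 : ℕ) : ℝ) * δ < 1 := by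
    rw [Nat.cast_sub (by omega)]
    push_cast
    linarith
  obtain ⟨N, hN, hdet⟩ := QTLP.eventuallyDeterminedBy_comb hδ₀ (by nlinarith) hm φ hφ
  have hcomb : comb δ ⊆ Set.Ici 0 := by
    rintro _ ⟨k, rfl⟩
    exact Set.mem_Ici.2 (by positivity)
  obtain ⟨k, -, hk⟩ := exists_comb_le_lt hδ₀ hN
  obtain ⟨K, hK⟩ : ∃ K : ℕ, N < K * δ := ⟨k + 1, by push_cast; exact hk⟩
  have hmany : QTLP.Sat (comb δ) φ (K * δ + 3 * δ / 4) :=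
    (h _ hcomb _ (by positivity)).2
      (le_encard_comb_inter_Ioo (k := K) hδ₀ (by linarith) (by linarith))
  have hfew := (h _ hcomb (K * δ + δ / 4) (by positivity)).1
    (hdet _ _ (by linarith) (by linarith)
      (iff_of_false (notMem_comb (k := K) hδ₀ (by linarith) (by linarith))
        (notMem_comb (k := K) hδ₀ (by linarith) (by linarith))) hmany)
  exact hfew.not_gt (encard_comb_inter_Ioo_lt (k := K) hδ₀ (by omega) (by linarith) (by linarith))
end

section
/- Let k ≥ 1 be an integer and let S ⊆ ℝ be a set invariant under every automorphism of the metric model M_k, i.e., g(S) = S for every strictly increasing bijection g : ℝ → ℝ with g(P_k) = P_k and g(x+1) = g(x)+1 for all x. Then S is one of the four trivial sets: ∅, ℝ, P_k, or ℝ ∖ P_k. -/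
/-- The set `P_k = {m/k : m ∈ ℤ}`. -/
def Pk (k : ℕ) : Set ℝ := {x : ℝ | ∃ m : ℤ, x = m / k}

/-- The increasing Möbius bijection of `[0, 1]` fixing `0` and `1` with derivative `c` at `0`. -/
noncomputable def unitMoebius (c t : ℝ) : ℝ := c * t / (1 + (c - 1) * t)

lemma unitMoebius_denom_pos {c t : ℝ} (hc : 0 < c) (h0 : 0 ≤ t) (h1 : t < 1) :
    0 < 1 + (c - 1) * t := by
  nlinarith [mul_nonneg hc.le h0]

lemma unitMoebius_nonneg {c t : ℝ} (hc : 0 < c) (h0 : 0 ≤ t) (h1 : t < 1) :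
    0 ≤ unitMoebius c t :=
  div_nonneg (mul_nonneg hc.le h0) (unitMoebius_denom_pos hc h0 h1).le

lemma unitMoebius_lt_one {c t : ℝ} (hc : 0 < c) (h0 : 0 ≤ t) (h1 : t < 1) :
    unitMoebius c t < 1 := by
  rw [unitMoebius, div_lt_one (unitMoebius_denom_pos hc h0 h1)]
  linarith

lemma unitMoebius_lt {c s t : ℝ} (hc : 0 < c) (hs : 0 ≤ s) (hst : s < t) (ht : t < 1) :
    unitMoebius c s < unitMoebius c t := by
  rw [unitMoebius, unitMoebius,
    div_lt_div_iff₀ (unitMoebius_denom_pos hc hs (hst.trans ht))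
      (unitMoebius_denom_pos hc (hs.trans hst.le) ht)]
  nlinarith [mul_pos hc (sub_pos.2 hst)]

lemma unitMoebius_unitMoebius_inv {c t : ℝ} (hc : 0 < c) (h0 : 0 ≤ t) (h1 : t < 1) :
    unitMoebius c (unitMoebius c⁻¹ t) = t := by
  have hd : 1 + (c⁻¹ - 1) * t ≠ 0 := (unitMoebius_denom_pos (inv_pos.2 hc) h0 h1).ne'
  have hs : unitMoebius c⁻¹ t * (1 + (c⁻¹ - 1) * t) = c⁻¹ * t := div_mul_cancel₀ _ hd
  have hd' : 1 + (c - 1) * unitMoebius c⁻¹ t ≠ 0 :=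
    (unitMoebius_denom_pos hc (unitMoebius_nonneg (inv_pos.2 hc) h0 h1)
      (unitMoebius_lt_one (inv_pos.2 hc) h0 h1)).ne'
  generalize unitMoebius c⁻¹ t = s at *
  rw [unitMoebius, div_eq_iff hd']
  field_simp at hs
  linear_combination hs

lemma exists_unitMoebius_eq {a b : ℝ} (ha : 0 < a) (ha' : a < 1) (hb : 0 < b) (hb' : b < 1) :
    ∃ c, 0 < c ∧ unitMoebius c a = b := by
  have h1 : 0 < 1 - a := sub_pos.2 ha'
  have h2 : 0 < 1 - b := sub_pos.2 hb'
  have hc : 0 < b * (1 - a) / (a * (1 - b)) := by positivity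
  refine ⟨_, hc, ?_⟩
  rw [unitMoebius, div_eq_iff (unitMoebius_denom_pos hc ha.le ha').ne']
  field_simp
  ring

/-- The extension of `unitMoebius c` to `ℝ` commuting with integer translations. -/
noncomputable def periodicMoebius (c t : ℝ) : ℝ := ⌊t⌋ + unitMoebius c (Int.fract t)

lemma periodicMoebius_intCast (c : ℝ) (m : ℤ) : periodicMoebius c m = m := by
  simp [periodicMoebius, unitMoebius]

lemma periodicMoebius_add_natCast (c t : ℝ) (n : ℕ) :
    periodicMoebius c (t + n) = periodicMoebius c t + n := by
  simp only [periodicMoebius, Int.floor_add_natCast, Int.fract_add_natCast]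
  push_cast
  ring

lemma periodicMoebius_strictMono {c : ℝ} (hc : 0 < c) : StrictMono (periodicMoebius c) := by
  intro s t hst
  have hs := unitMoebius_lt_one hc (Int.fract_nonneg s) (Int.fract_lt_one s)
  have ht := unitMoebius_nonneg hc (Int.fract_nonneg t) (Int.fract_lt_one t)
  unfold periodicMoebius
  rcases (Int.floor_le_floor hst.le).eq_or_lt with h | h
  · rw [h]
    refine add_lt_add_right (unitMoebius_lt hc (Int.fract_nonneg s) ?_ (Int.fract_lt_one t)) _
    rw [Int.fract, Int.fract, h]
    linarith
  · have : (⌊s⌋ : ℝ) + 1 ≤ ⌊t⌋ := by exact_mod_cast h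
    linarith

lemma periodicMoebius_surjective {c : ℝ} (hc : 0 < c) :
    Function.Surjective (periodicMoebius c) := by
  intro t
  have h0 := Int.fract_nonneg t
  have h1 := Int.fract_lt_one t
  have hf : Int.fract (unitMoebius c⁻¹ (Int.fract t)) = unitMoebius c⁻¹ (Int.fract t) :=
    Int.fract_eq_self.2 ⟨unitMoebius_nonneg (inv_pos.2 hc) h0 h1,
      unitMoebius_lt_one (inv_pos.2 hc) h0 h1⟩
  refine ⟨⌊t⌋ + unitMoebius c⁻¹ (Int.fract t), ?_⟩
  rw [periodicMoebius, Int.fract_intCast_add, hf, unitMoebius_unitMoebius_inv hc h0 h1,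
    Int.floor_intCast_add, Int.floor_eq_zero_iff.2 (Int.fract_eq_self.1 hf), add_zero,
    Int.floor_add_fract]

lemma mem_Pk_iff {k : ℕ} (hk : 1 ≤ k) {x : ℝ} : x ∈ Pk k ↔ ∃ m : ℤ, k * x = m := by
  have hk0 : (k : ℝ) ≠ 0 := by positivity
  simp only [Pk, Set.mem_ofPred_eq, eq_div_iff hk0, mul_comm x]

/-- If `S` is invariant under the automorphisms of `M_k`, then it is invariant under integer
translations and periodic Möbius maps in the coordinate `k * x`. -/
lemma mem_of_periodicMoebius_eq {k : ℕ} (hk : 1 ≤ k) {S : Set ℝ}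
    (hS : ∀ g : ℝ → ℝ, StrictMono g → Function.Bijective g → g '' Pk k = Pk k →
      (∀ x : ℝ, g (x + 1) = g x + 1) → g '' S = S)
    {c : ℝ} (hc : 0 < c) (n : ℤ) {x y : ℝ} (hx : x ∈ S)
    (hxy : periodicMoebius c (k * x) + n = k * y) : y ∈ S := by
  have hk0 : (0 : ℝ) < k := by positivity
  have hmono : StrictMono fun x : ℝ => (periodicMoebius c (k * x) + n) / k := by
    intro s t hst
    have := periodicMoebius_strictMono hc (mul_lt_mul_of_pos_left hst hk0)
    exact div_lt_div_of_pos_right (by linarith) hk0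
  have hsurj : Function.Surjective fun x : ℝ => (periodicMoebius c (k * x) + n) / k := by
    intro z
    obtain ⟨t, ht⟩ := periodicMoebius_surjective hc (k * z - n)
    refine ⟨t / k, ?_⟩
    simp only [mul_div_cancel₀ t hk0.ne', ht]
    field_simp
    ring
  have himage : (fun x : ℝ => (periodicMoebius c (k * x) + n) / k) '' Pk k = Pk k := by
    ext z
    constructor
    · rintro ⟨w, hw, rfl⟩
      obtain ⟨m, hm⟩ := (mem_Pk_iff hk).1 hw
      exact ⟨m + n, by simp [hm, periodicMoebius_intCast]⟩
    · rintro ⟨m, rfl⟩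
      refine ⟨(m - n : ℤ) / k, ⟨m - n, rfl⟩, ?_⟩
      simp only [mul_div_cancel₀ _ hk0.ne', periodicMoebius_intCast]
      push_cast
      ring
  have h := hS _ hmono ⟨hmono.injective, hsurj⟩ himage (fun x => by
    simp only [mul_add, mul_one, periodicMoebius_add_natCast]
    field_simp
    ring)
  rw [← h]
  exact ⟨x, hx, by simp only [hxy]; field_simp⟩

/-- Any two points on the same side of `P_k` are related by an automorphism of `M_k`, so an
invariant set containing one contains the other. -/
lemma mem_of_mem_Pk_iff {k : ℕ} (hk : 1 ≤ k) {S : Set ℝ}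
    (hS : ∀ g : ℝ → ℝ, StrictMono g → Function.Bijective g → g '' Pk k = Pk k →
      (∀ x : ℝ, g (x + 1) = g x + 1) → g '' S = S)
    {x y : ℝ} (hxy : x ∈ Pk k ↔ y ∈ Pk k) (hx : x ∈ S) : y ∈ S := by
  by_cases hxP : x ∈ Pk k
  · obtain ⟨m, hm⟩ := (mem_Pk_iff hk).1 hxP
    obtain ⟨n, hn⟩ := (mem_Pk_iff hk).1 (hxy.1 hxP)
    refine mem_of_periodicMoebius_eq hk hS one_pos (n - m) hx ?_
    rw [hm, hn, periodicMoebius_intCast]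
    push_cast
    ring
  · have hpos : ∀ z, z ∉ Pk k → 0 < Int.fract ((k : ℝ) * z) := fun z hz =>
      (Int.fract_nonneg _).lt_of_ne' fun h => hz <| (mem_Pk_iff hk).2
        ⟨⌊(k : ℝ) * z⌋, by linarith [Int.floor_add_fract ((k : ℝ) * z)]⟩
    obtain ⟨c, hc, hcx⟩ := exists_unitMoebius_eq (hpos x hxP) (Int.fract_lt_one _)
      (hpos y (mt hxy.2 hxP)) (Int.fract_lt_one _)
    refine mem_of_periodicMoebius_eq hk hS hc (⌊(k : ℝ) * y⌋ - ⌊(k : ℝ) * x⌋) hx ?_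
    rw [periodicMoebius, hcx]
    push_cast
    linarith [Int.floor_add_fract ((k : ℝ) * y)]

/-- Any set invariant under every automorphism of the metric model `M_k` is one of the
four trivial sets `∅`, `ℝ`, `P_k`, `ℝ ∖ P_k`. -/
theorem invariant_sets_are_trivial (k : ℕ) (hk : 1 ≤ k) (S : Set ℝ)
    (hS : ∀ g : ℝ → ℝ, StrictMono g → Function.Bijective g → g '' Pk k = Pk k →
      (∀ x : ℝ, g (x + 1) = g x + 1) → g '' S = S) :
    S = ∅ ∨ S = Set.univ ∨ S = Pk k ∨ S = Set.univ \ Pk k := by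
  have key : ∀ {x y : ℝ}, (x ∈ Pk k ↔ y ∈ Pk k) → x ∈ S → y ∈ S :=
    fun h => mem_of_mem_Pk_iff hk hS h
  by_cases hP : ∃ x ∈ S, x ∈ Pk k
  · obtain ⟨x, hxS, hxP⟩ := hP
    by_cases hQ : ∃ y ∈ S, y ∉ Pk k
    · obtain ⟨y, hyS, hyP⟩ := hQ
      refine Or.inr (Or.inl (Set.eq_univ_of_forall fun z => ?_))
      by_cases hz : z ∈ Pk k
      · exact key (iff_of_true hxP hz) hxS
      · exact key (iff_of_false hyP hz) hyS
    · push Not at hQ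
      exact Or.inr (Or.inr (Or.inl (Set.Subset.antisymm hQ
        fun z hz => key (iff_of_true hxP hz) hxS)))
  · push Not at hP
    rcases S.eq_empty_or_nonempty with hE | ⟨y, hyS⟩
    · exact Or.inl hE
    · exact Or.inr (Or.inr (Or.inr (Set.Subset.antisymm (fun z hz => ⟨trivial, hP z hz⟩)
        fun z hz => key (iff_of_false (hP y hyS) hz.2) hyS)))
end

section
/- Fix n and let S_n be the set of localizations of the truth tables of all TL_n modalities. Let k, l ≥ 1 be integers. If every formula of S_n defines the same trivial truth set in M_k and in M_l (that is, for each ψ(t₀) ∈ S_n, the truth set of ψ in M_k and the truth set of ψ in M_l are the trivial sets of the same type among ∅, ℝ, P, ¬P), then every TL_n formula defines the same trivial truth set in M_k and in M_l. -/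
/-- Formulas of second-order monadic logic of order `L` over the signature `<`, `B`, `P`,
in de Bruijn style: `Fml m n` has first-order variables `Fin m` and monadic second-order
variables `Fin n`. -/
inductive Fml : ℕ → ℕ → Type
  | eq {m n : ℕ} (i j : Fin m) : Fml m n
  | lt {m n : ℕ} (i j : Fin m) : Fml m n
  | B {m n : ℕ} (i j : Fin m) : Fml m n
  | P {m n : ℕ} (i : Fin m) : Fml m n
  | X {m n : ℕ} (x : Fin n) (i : Fin m) : Fml m n
  | not {m n : ℕ} (φ : Fml m n) : Fml m n
  | and {m n : ℕ} (φ ψ : Fml m n) : Fml m n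
  | exFO {m n : ℕ} (φ : Fml (m + 1) n) : Fml m n
  | exSO {m n : ℕ} (φ : Fml m (n + 1)) : Fml m n

/-- Satisfaction of an `L`-formula in a structure with domain `D`, order `lo`,
binary relation `Bo` and unary predicate `Pred`, under assignments `v` (first-order)
and `w` (second-order). -/
def Fml.Sat {D : Type} (lo Bo : D → D → Prop) (Pred : Set D) :
    ∀ {m n : ℕ}, Fml m n → (Fin m → D) → (Fin n → Set D) → Prop
  | _, _, .eq i j, v, _ => v i = v j
  | _, _, .lt i j, v, _ => lo (v i) (v j)
  | _, _, .B i j, v, _ => Bo (v i) (v j)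
  | _, _, .P i, v, _ => v i ∈ Pred
  | _, _, .X x i, v, w => v i ∈ w x
  | _, _, .not φ, v, w => ¬ Fml.Sat lo Bo Pred φ v w
  | _, _, .and φ ψ, v, w => Fml.Sat lo Bo Pred φ v w ∧ Fml.Sat lo Bo Pred ψ v w
  | _, _, .exFO φ, v, w => ∃ d : D, Fml.Sat lo Bo Pred φ (Fin.cons d v) w
  | _, _, .exSO φ, v, w => ∃ A : Set D, Fml.Sat lo Bo Pred φ v (Fin.cons A w)

/-- Quantifier depth (counting both first- and second-order quantifiers). -/
def Fml.qd : ∀ {m n : ℕ}, Fml m n → ℕ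
  | _, _, .eq _ _ => 0
  | _, _, .lt _ _ => 0
  | _, _, .B _ _ => 0
  | _, _, .P _ => 0
  | _, _, .X _ _ => 0
  | _, _, .not φ => φ.qd
  | _, _, .and φ ψ => max φ.qd ψ.qd
  | _, _, .exFO φ => φ.qd + 1
  | _, _, .exSO φ => φ.qd + 1

/-- Satisfaction over the real line: `<` is the usual order and `B(t,s) ↔ s = t + 1`. -/
def Fml.SatR (Pred : Set ℝ) {m n : ℕ} (φ : Fml m n)
    (v : Fin m → ℝ) (w : Fin n → Set ℝ) : Prop :=
  Fml.Sat (· < ·) (fun t s => s = t + 1) Pred φ v w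

/-- Formulas of the temporal logic `TL_n`: built from the atom `p` and `⊤` by Boolean
connectives and applications of modalities whose truth tables are `L`-formulas with one
free first-order variable, `j` free monadic variables, and quantifier depth at most `n`. -/
inductive TL (n : ℕ) : Type
  | top : TL n
  | atom : TL n
  | not : TL n → TL n
  | and : TL n → TL n → TL n
  | mod : (j : ℕ) → (O : Fml 1 j) → O.qd ≤ n → (Fin j → TL n) → TL n

/-- The truth set of a `TL_n` formula in the structure `(ℝ, <, B, P)` with `P`
interpreted as `Pred`. -/
def TL.truth {n : ℕ} (Pred : Set ℝ) : TL n → Set ℝ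
  | .top => Set.univ
  | .atom => Pred
  | .not φ => (TL.truth Pred φ)ᶜ
  | .and φ ψ => TL.truth Pred φ ∩ TL.truth Pred ψ
  | .mod _ O _ args =>
      {t : ℝ | Fml.SatR Pred O (fun _ => t) (fun i => TL.truth Pred (args i))}

/-- The four trivial predicate types: `True`, `False`, `P`, `¬P`. -/
inductive Triv : Type
  | tt : Triv
  | ff : Triv
  | pp : Triv
  | np : Triv

/-- Interpretation of a trivial predicate type in a model whose interpretation of `P`
is `Pred`. -/
def Triv.interp (Pred : Set ℝ) : Triv → Set ℝ
  | .tt => Set.univ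
  | .ff => ∅
  | .pp => Pred
  | .np => Predᶜ

/-- The complement of a trivial predicate type. -/
def Triv.compl : Triv → Triv
  | .tt => .ff
  | .ff => .tt
  | .pp => .np
  | .np => .pp

theorem Triv.interp_compl (Pred : Set ℝ) (τ : Triv) :
    τ.compl.interp Pred = (τ.interp Pred)ᶜ := by
  cases τ <;> simp [Triv.compl, Triv.interp]

/-- The intersection of two trivial predicate types. -/
def Triv.inter : Triv → Triv → Triv
  | .tt, τ => τ
  | .ff, _ => .ff
  | .pp, .tt => .pp
  | .pp, .pp => .pp
  | .pp, _ => .ff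
  | .np, .tt => .np
  | .np, .np => .np
  | .np, _ => .ff

theorem Triv.interp_inter (Pred : Set ℝ) (σ τ : Triv) :
    (σ.inter τ).interp Pred = σ.interp Pred ∩ τ.interp Pred := by
  cases σ <;> cases τ <;> simp [Triv.inter, Triv.interp]

/-- If every localization of a truth table of a `TL_n` modality (obtained by substituting
trivial predicates for the monadic variables) defines the same trivial truth set in `M_k`
and in `M_l`, then every `TL_n` formula defines the same trivial truth set in `M_k` and
in `M_l`. -/
theorem TLn_trivial_from_localizations (n k l : ℕ) (hk : 1 ≤ k) (hl : 1 ≤ l)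
    (hloc : ∀ (j : ℕ) (O : Fml 1 j), O.qd ≤ n → ∀ T : Fin j → Triv,
      ∃ τ : Triv,
        {t : ℝ | Fml.SatR (Pk k) O (fun _ => t) (fun i => (T i).interp (Pk k))} =
          τ.interp (Pk k) ∧
        {t : ℝ | Fml.SatR (Pk l) O (fun _ => t) (fun i => (T i).interp (Pk l))} =
          τ.interp (Pk l)) :
    ∀ φ : TL n, ∃ τ : Triv,
      TL.truth (Pk k) φ = τ.interp (Pk k) ∧ TL.truth (Pk l) φ = τ.interp (Pk l) := by
  intro φ
  induction φ with
  | top => exact ⟨.tt, rfl, rfl⟩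
  | atom => exact ⟨.pp, rfl, rfl⟩
  | not φ ih =>
    obtain ⟨τ, h₁, h₂⟩ := ih
    exact ⟨τ.compl, by rw [TL.truth, h₁, τ.interp_compl], by rw [TL.truth, h₂, τ.interp_compl]⟩
  | and φ ψ ihφ ihψ =>
    obtain ⟨σ, h₁, h₂⟩ := ihφ
    obtain ⟨τ, h₃, h₄⟩ := ihψ
    exact ⟨σ.inter τ, by rw [TL.truth, h₁, h₃, σ.interp_inter],
      by rw [TL.truth, h₂, h₄, σ.interp_inter]⟩
  | mod j O hO args ih =>
    choose T hT₁ hT₂ using ih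
    simpa only [TL.truth, hT₁, hT₂] using hloc j O hO T
end
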